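/- Monotonicity of the phase function along the steepest ascent curve (part of Lemma 3.1): Fix an integer M ≥ 1, let x0 ∈ (0, (M+1)^{M+1}/M^M) and let φ* ∈ (0, π/(M+1)) satisfy x0 = v(φ*). Then the derivative (d/dφ) Re F̂(ζ(φ); x0) is strictly negative for φ ∈ (0, φ*) and strictly positive for φ ∈ (φ*, π/(M+1)); the same sign pattern holds for (d/dφ) Re F̂(conj(ζ(φ)); x0). -/

import Mathlib

open Complex Real Set Filter

/-- The phase function `F̂(z; a)` (principal branch of `log`). -/
noncomputable def Fhat (M : ℕ) (z : ℂ) (a : ℝ) : ℂ :=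
  ((M : ℂ) + 1) * z * (Complex.log z - 1) - (z - 1) * (Complex.log (z - 1) - 1) -
    z * (Real.log a : ℂ)

/-- The parametrization `ζ(φ)` of the steepest ascent curve. -/
noncomputable def zeta (M : ℕ) (φ : ℝ) : ℂ :=
  ((Real.sin ((M + 1) * φ) / Real.sin (M * φ) : ℝ) : ℂ) * Complex.exp ((φ : ℂ) * Complex.I)

/-- The parametrization `v(φ)` of the spectral variable. -/
noncomputable def v (M : ℕ) (φ : ℝ) : ℝ :=
  Real.sin ((M + 1) * φ) ^ (M + 1) / (Real.sin φ * Real.sin (M * φ) ^ M)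

theorem abs_sin_nat_mul_le (n : ℕ) (x : ℝ) : |Real.sin (n * x)| ≤ n * |Real.sin x| := by
  induction n with
  | zero => simp
  | succ k ih =>
    have h : Real.sin ((k + 1 : ℕ) * x) =
        Real.sin (k * x) * Real.cos x + Real.cos (k * x) * Real.sin x := by
      rw [← Real.sin_add]; push_cast; ring_nf
    rw [h]
    refine (abs_add_le _ _).trans ?_
    rw [abs_mul, abs_mul]
    have h1 := mul_le_of_le_one_right (abs_nonneg (Real.sin (k * x))) (Real.abs_cos_le_one x)
    have h2 := mul_le_of_le_one_left (abs_nonneg (Real.sin x)) (Real.abs_cos_le_one (k * x))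
    push_cast
    linarith

theorem sin_pos_of_mem_Ioo_pi_div {M : ℕ} {φ c : ℝ} (hφ : φ ∈ Ioo 0 (Real.pi / ((M : ℝ) + 1)))
    (hc : 0 < c) (hcM : c ≤ M + 1) : 0 < Real.sin (c * φ) := by
  have hM : (0 : ℝ) < M + 1 := by positivity
  have h := (lt_div_iff₀ hM).1 hφ.2
  have h0 := hφ.1
  exact Real.sin_pos_of_pos_of_lt_pi (by positivity) (by nlinarith)

/-- The modulus of `zeta M φ`. -/
noncomputable def zetaModulus (M : ℕ) (φ : ℝ) : ℝ :=
  Real.sin ((M + 1) * φ) / Real.sin (M * φ)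

section

variable {M : ℕ} {φ : ℝ}

theorem zetaModulus_pos (hM : 1 ≤ M) (hφ : φ ∈ Ioo 0 (Real.pi / ((M : ℝ) + 1))) :
    0 < zetaModulus M φ :=
  div_pos (sin_pos_of_mem_Ioo_pi_div hφ (by positivity) le_rfl)
    (sin_pos_of_mem_Ioo_pi_div hφ (by positivity) (by linarith))

theorem exists_hasDerivAt_zetaModulus_neg (hM : 1 ≤ M)
    (hφ : φ ∈ Ioo 0 (Real.pi / ((M : ℝ) + 1))) :
    ∃ d < 0, HasDerivAt (zetaModulus M) d φ := by
  have hA := sin_pos_of_mem_Ioo_pi_div hφ (c := M + 1) (by positivity) le_rfl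
  have hB := sin_pos_of_mem_Ioo_pi_div hφ (c := M) (by positivity) (by linarith)
  have hC := sin_pos_of_mem_Ioo_pi_div hφ one_pos (by simp)
  rw [one_mul] at hC
  have h1 : HasDerivAt (fun t : ℝ => Real.sin ((M + 1) * t))
      (Real.cos ((M + 1) * φ) * (M + 1)) φ := by
    simpa using ((hasDerivAt_id φ).const_mul ((M : ℝ) + 1)).sin
  have h2 : HasDerivAt (fun t : ℝ => Real.sin (M * t)) (Real.cos (M * φ) * M) φ := by
    simpa using ((hasDerivAt_id φ).const_mul (M : ℝ)).sin
  refine ⟨_, ?_, h1.div h2 hB.ne'⟩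
  refine div_neg_of_neg_of_pos ?_ (by positivity)
  have hsin : Real.sin ((M + 1) * φ) * Real.cos (M * φ) -
      Real.cos ((M + 1) * φ) * Real.sin (M * φ) = Real.sin φ := by
    rw [← Real.sin_sub]; ring_nf
  have hle : Real.sin (M * φ) ≤ M * Real.sin φ := by
    have := abs_sin_nat_mul_le M φ
    rwa [abs_of_pos hB, abs_of_pos hC] at this
  have hcos : Real.cos ((M + 1) * φ) < 1 := by
    nlinarith [Real.sin_sq_add_cos_sq ((M + 1) * φ)]
  have := mul_lt_of_lt_one_left hB hcos
  linear_combination this + hle - (M : ℝ) * hsin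

theorem strictAntiOn_zetaModulus (hM : 1 ≤ M) :
    StrictAntiOn (zetaModulus M) (Ioo 0 (Real.pi / ((M : ℝ) + 1))) := by
  refine strictAntiOn_of_deriv_neg (convex_Ioo _ _) ?_ ?_
  · intro φ hφ
    obtain ⟨d, -, h⟩ := exists_hasDerivAt_zetaModulus_neg hM hφ
    exact h.continuousAt.continuousWithinAt
  · intro φ hφ
    rw [interior_Ioo] at hφ
    obtain ⟨d, hd, h⟩ := exists_hasDerivAt_zetaModulus_neg hM hφ
    rwa [h.deriv]

theorem strictAntiOn_sin_mul_div_sin (hM : 1 ≤ M) :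
    StrictAntiOn (fun φ : ℝ => Real.sin ((M + 1) * φ) / Real.sin φ)
      (Ioo 0 (Real.pi / ((M : ℝ) + 1))) := by
  induction M, hM using Nat.le_induction with
  | base => simpa [zetaModulus, StrictAntiOn] using strictAntiOn_zetaModulus (M := 1) le_rfl
  | succ k hk ih =>
    have hsub : Ioo 0 (Real.pi / (((k + 1 : ℕ) : ℝ) + 1)) ⊆ Ioo 0 (Real.pi / ((k : ℝ) + 1)) := by
      refine Ioo_subset_Ioo_right ?_
      push_cast
      gcongr
      linarith
    have hfactor : ∀ t ∈ Ioo 0 (Real.pi / (((k + 1 : ℕ) : ℝ) + 1)),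
        Real.sin (((k + 1 : ℕ) + 1) * t) / Real.sin t =
          zetaModulus (k + 1) t * (Real.sin ((k + 1) * t) / Real.sin t) := by
      intro t ht
      have h := sin_pos_of_mem_Ioo_pi_div (hsub ht) (c := k + 1) (by positivity) le_rfl
      rw [zetaModulus, Nat.cast_add_one, div_mul_div_cancel₀ h.ne']
    intro a ha b hb hab
    simp only [hfactor a ha, hfactor b hb]
    refine mul_lt_mul'' (strictAntiOn_zetaModulus (by lia) ha hb hab) (ih (hsub ha) (hsub hb) hab)
      (zetaModulus_pos (by lia) hb).le (div_pos ?_ ?_).le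
    · exact sin_pos_of_mem_Ioo_pi_div (hsub hb) (by positivity) le_rfl
    · simpa using sin_pos_of_mem_Ioo_pi_div hb one_pos (by simp; positivity)

theorem v_eq_zetaModulus_pow_mul (M : ℕ) (φ : ℝ) :
    v M φ = zetaModulus M φ ^ M * (Real.sin ((M + 1) * φ) / Real.sin φ) := by
  rw [v, zetaModulus, div_pow, div_mul_div_comm, pow_succ, mul_comm (Real.sin φ)]

theorem v_pos (hM : 1 ≤ M) (hφ : φ ∈ Ioo 0 (Real.pi / ((M : ℝ) + 1))) : 0 < v M φ := by
  rw [v_eq_zetaModulus_pow_mul]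
  have hC := sin_pos_of_mem_Ioo_pi_div hφ one_pos (by simp)
  rw [one_mul] at hC
  exact mul_pos (pow_pos (zetaModulus_pos hM hφ) _)
    (div_pos (sin_pos_of_mem_Ioo_pi_div hφ (by positivity) le_rfl) hC)

theorem strictAntiOn_v (hM : 1 ≤ M) :
    StrictAntiOn (v M) (Ioo 0 (Real.pi / ((M : ℝ) + 1))) := by
  intro a ha b hb hab
  simp only [v_eq_zetaModulus_pow_mul]
  have hC := sin_pos_of_mem_Ioo_pi_div hb one_pos (by simp)
  rw [one_mul] at hC
  have hr := zetaModulus_pos hM hb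
  exact mul_lt_mul'' (pow_lt_pow_left₀ (strictAntiOn_zetaModulus hM ha hb hab) hr.le (by lia))
    (strictAntiOn_sin_mul_div_sin hM ha hb hab) (by positivity)
    (div_pos (sin_pos_of_mem_Ioo_pi_div hb (by positivity) le_rfl) hC).le

theorem zeta_sub_one (hB : Real.sin (M * φ) ≠ 0) :
    zeta M φ - 1 = ((Real.sin φ / Real.sin (M * φ) : ℝ) : ℂ) *
      Complex.exp ((((M + 1) * φ : ℝ) : ℂ) * Complex.I) := by
  have hsin : Real.sin (M * φ) = Real.sin ((M + 1) * φ) * Real.cos φ -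
      Real.cos ((M + 1) * φ) * Real.sin φ := by
    rw [← Real.sin_sub]; ring_nf
  apply Complex.ext
  · rw [zeta, Complex.sub_re, Complex.re_ofReal_mul, Complex.re_ofReal_mul,
      Complex.exp_ofReal_mul_I_re, Complex.exp_ofReal_mul_I_re, Complex.one_re]
    field_simp
    linear_combination -hsin
  · rw [zeta, Complex.sub_im, Complex.im_ofReal_mul, Complex.im_ofReal_mul,
      Complex.exp_ofReal_mul_I_im, Complex.exp_ofReal_mul_I_im, Complex.one_im]
    ring

theorem zeta_im_pos (hM : 1 ≤ M) (hφ : φ ∈ Ioo 0 (Real.pi / ((M : ℝ) + 1))) :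
    0 < (zeta M φ).im := by
  have hC := sin_pos_of_mem_Ioo_pi_div hφ one_pos (by simp)
  rw [one_mul] at hC
  rw [zeta, Complex.im_ofReal_mul, Complex.exp_ofReal_mul_I_im]
  exact mul_pos (zetaModulus_pos hM hφ) hC

theorem log_ofReal_mul_exp_mul_I {r θ : ℝ} (hr : 0 < r) (hθ : θ ∈ Ioc (-Real.pi) Real.pi) :
    Complex.log (r * Complex.exp (θ * Complex.I)) = Real.log r + θ * Complex.I := by
  rw [Complex.log_ofReal_mul hr (Complex.exp_ne_zero _), Complex.log_exp] <;> simp [hθ.1, hθ.2]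

theorem log_zeta_sub_log_zeta_sub_one (hM : 1 ≤ M)
    (hφ : φ ∈ Ioo 0 (Real.pi / ((M : ℝ) + 1))) :
    ((M : ℂ) + 1) * Complex.log (zeta M φ) - Complex.log (zeta M φ - 1) =
      (Real.log (v M φ) : ℂ) := by
  have hA := sin_pos_of_mem_Ioo_pi_div hφ (c := M + 1) (by positivity) le_rfl
  have hB := sin_pos_of_mem_Ioo_pi_div hφ (c := M) (by positivity) (by linarith)
  have hC := sin_pos_of_mem_Ioo_pi_div hφ one_pos (by simp)
  rw [one_mul] at hC
  have hM0 : (0 : ℝ) ≤ M := by positivity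
  have h0 := hφ.1
  have hlt := (lt_div_iff₀ (by positivity : (0 : ℝ) < M + 1)).1 hφ.2
  have hpos : 0 < (M + 1) * φ := by positivity
  rw [zeta_sub_one hB.ne', zeta,
    log_ofReal_mul_exp_mul_I (div_pos hA hB) ⟨by nlinarith, by nlinarith⟩,
    log_ofReal_mul_exp_mul_I (div_pos hC hB) ⟨by linarith [Real.pi_pos], by linarith⟩, v,
    Real.log_div hA.ne' hB.ne', Real.log_div hC.ne' hB.ne',
    Real.log_div (by positivity) (by positivity), Real.log_mul hC.ne' (by positivity),
    Real.log_pow, Real.log_pow]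
  push_cast
  ring

theorem hasDerivAt_Fhat {z : ℂ} (a : ℝ) (hz : z.im ≠ 0) :
    HasDerivAt (fun z => Fhat M z a)
      (((M : ℂ) + 1) * Complex.log z - Complex.log (z - 1) - (Real.log a : ℂ)) z := by
  have hs : z ∈ slitPlane := Or.inr hz
  have hs1 : z - 1 ∈ slitPlane := Or.inr (by simpa using hz)
  have h0 := slitPlane_ne_zero hs
  have h1 := slitPlane_ne_zero hs1
  have hid := hasDerivAt_id' z
  have hd := (((hid.const_mul ((M : ℂ) + 1)).mul ((hid.clog hs).sub_const 1)).sub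
    ((hid.sub_const 1).mul (((hid.sub_const 1).clog hs1).sub_const 1))).sub
    (hid.mul_const (Real.log a : ℂ))
  refine hd.congr_deriv ?_
  field_simp
  ring

theorem Fhat_conj {z : ℂ} (a : ℝ) (hz : z.im ≠ 0) :
    Fhat M ((starRingEnd ℂ) z) a = (starRingEnd ℂ) (Fhat M z a) := by
  have h : z.arg ≠ Real.pi := fun h => hz (Complex.arg_eq_pi_iff.1 h).2
  have h1 : (z - 1).arg ≠ Real.pi := fun h => hz (by simpa using (Complex.arg_eq_pi_iff.1 h).2)
  have hsub : (starRingEnd ℂ) z - 1 = (starRingEnd ℂ) (z - 1) := by simp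
  rw [Fhat, hsub, Complex.log_conj _ h, Complex.log_conj _ h1, Fhat]
  simp only [map_sub, map_mul, map_add, map_one, Complex.conj_ofReal, map_natCast]

theorem exists_hasDerivAt_zeta_re_neg (hM : 1 ≤ M)
    (hφ : φ ∈ Ioo 0 (Real.pi / ((M : ℝ) + 1))) :
    ∃ d : ℂ, d.re < 0 ∧ HasDerivAt (zeta M) d φ := by
  obtain ⟨d, hd, h⟩ := exists_hasDerivAt_zetaModulus_neg hM hφ
  have hexp : HasDerivAt (fun t : ℝ => Complex.exp ((t : ℂ) * Complex.I))
      (Complex.exp ((φ : ℂ) * Complex.I) * Complex.I) φ := by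
    simpa using ((hasDerivAt_id φ).ofReal_comp.mul_const Complex.I).cexp
  refine ⟨_, ?_, h.ofReal_comp.mul hexp⟩
  have hC := sin_pos_of_mem_Ioo_pi_div hφ one_pos (by simp)
  rw [one_mul] at hC
  have hcos : 0 ≤ Real.cos φ := by
    have hM' : (1 : ℝ) ≤ M := by exact_mod_cast hM
    have hle : Real.pi / ((M : ℝ) + 1) ≤ Real.pi / 2 := by
      gcongr
      linarith
    exact Real.cos_nonneg_of_mem_Icc
      ⟨by linarith [hφ.1, Real.pi_pos], by linarith [hφ.2]⟩
  have hr := mul_pos (zetaModulus_pos hM hφ) hC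
  have hdc := mul_nonpos_of_nonpos_of_nonneg hd.le hcos
  rw [Complex.add_re, Complex.re_ofReal_mul, Complex.re_ofReal_mul, Complex.mul_re,
    Complex.I_re, Complex.I_im,
    Complex.exp_ofReal_mul_I_re, Complex.exp_ofReal_mul_I_im]
  linarith

theorem exists_deriv_re_Fhat_zeta (hM : 1 ≤ M) (a : ℝ)
    (hφ : φ ∈ Ioo 0 (Real.pi / ((M : ℝ) + 1))) :
    ∃ c < 0,
      deriv (fun t : ℝ => (Fhat M (zeta M t) a).re) φ =
        (Real.log (v M φ) - Real.log a) * c ∧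
      deriv (fun t : ℝ => (Fhat M ((starRingEnd ℂ) (zeta M t)) a).re) φ =
        (Real.log (v M φ) - Real.log a) * c := by
  obtain ⟨d, hd, h⟩ := exists_hasDerivAt_zeta_re_neg hM hφ
  have hF := (hasDerivAt_Fhat (M := M) a (zeta_im_pos hM hφ).ne').comp φ h
  rw [log_zeta_sub_log_zeta_sub_one hM hφ, ← Complex.ofReal_sub] at hF
  have hre := Complex.reCLM.hasFDerivAt.comp_hasDerivAt φ hF
  have hmain : deriv (fun t : ℝ => (Fhat M (zeta M t) a).re) φ =
      (Real.log (v M φ) - Real.log a) * d.re := by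
    refine (HasDerivAt.deriv hre).trans ?_
    rw [Complex.reCLM_apply, Complex.re_ofReal_mul]
  refine ⟨d.re, hd, hmain, ?_⟩
  rw [← hmain]
  refine Filter.EventuallyEq.deriv_eq ?_
  filter_upwards [isOpen_Ioo.mem_nhds hφ] with t ht
  rw [Fhat_conj a (zeta_im_pos hM ht).ne', Complex.conj_re]

end

/-- Monotonicity of the phase function along the steepest ascent curve
(part of Lemma 3.1). -/
theorem monotonicity_along_ascent_curve
    (M : ℕ) (hM : 1 ≤ M) (x0 : ℝ)
    (hx0 : x0 ∈ Set.Ioo (0 : ℝ) (((M : ℝ) + 1) ^ (M + 1) / (M : ℝ) ^ M))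
    (φs : ℝ) (hφs : φs ∈ Set.Ioo (0 : ℝ) (Real.pi / ((M : ℝ) + 1)))
    (hpar : x0 = v M φs) :
    (∀ φ ∈ Set.Ioo (0 : ℝ) φs,
      deriv (fun t : ℝ => (Fhat M (zeta M t) x0).re) φ < 0 ∧
      deriv (fun t : ℝ => (Fhat M ((starRingEnd ℂ) (zeta M t)) x0).re) φ < 0) ∧
    (∀ φ ∈ Set.Ioo φs (Real.pi / ((M : ℝ) + 1)),
      0 < deriv (fun t : ℝ => (Fhat M (zeta M t) x0).re) φ ∧
      0 < deriv (fun t : ℝ => (Fhat M ((starRingEnd ℂ) (zeta M t)) x0).re) φ) := by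
  subst hpar
  refine ⟨fun φ hφ => ?_, fun φ hφ => ?_⟩
  · have hmem : φ ∈ Ioo 0 (Real.pi / ((M : ℝ) + 1)) := ⟨hφ.1, hφ.2.trans hφs.2⟩
    obtain ⟨c, hc, h1, h2⟩ := exists_deriv_re_Fhat_zeta hM (v M φs) hmem
    have hlog := Real.log_lt_log hx0.1 (strictAntiOn_v hM hmem hφs hφ.2)
    have hneg := mul_neg_of_pos_of_neg (sub_pos.2 hlog) hc
    exact ⟨h1 ▸ hneg, h2 ▸ hneg⟩
  · have hmem : φ ∈ Ioo 0 (Real.pi / ((M : ℝ) + 1)) := ⟨hφs.1.trans hφ.1, hφ.2⟩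
    obtain ⟨c, hc, h1, h2⟩ := exists_deriv_re_Fhat_zeta hM (v M φs) hmem
    have hlog := Real.log_lt_log (v_pos hM hmem) (strictAntiOn_v hM hφs hmem hφ.1)
    have hpos := mul_pos_of_neg_of_neg (sub_neg.2 hlog) hc
    exact ⟨h1 ▸ hpos, h2 ▸ hpos⟩
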